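/- Let F be a finite set of features with model π, instance v and similarity relations as above, and let ν_a(S) = 1 if S is a WAXp and 0 otherwise. Let P₁, …, P_r (r ≥ 1) be any finite list of permutations of F, and for a permutation P let Pref_P(i) denote the set of features preceding i in P. If feature i ∈ F is irrelevant (belongs to no AXp), then the permutation-sampling (CGT) estimate of its Shapley value is exactly zero: ŝ_i = (1/r) Σ_{j=1}^r (ν_a(Pref_{P_j}(i) ∪ {i}) − ν_a(Pref_{P_j}(i))) = 0. -/

import Mathlib

open Finset

/-- A set `S` of features is a weak abductive explanation (WAXp): for every point `x`
of feature space, if `x` is similar to `v` on all features in `S`, then the model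
output at `x` is similar to the output at `v`. -/
def WAXp {m : ℕ} {D : Fin m → Type*} {T : Type*}
    (π : (∀ i, D i) → T) (v : ∀ i, D i)
    (simD : ∀ i, D i → D i → Prop) (simT : T → T → Prop)
    (S : Finset (Fin m)) : Prop :=
  ∀ x : ∀ i, D i, (∀ i ∈ S, simD i (x i) (v i)) → simT (π x) (π v)

/-- An AXp is a subset-minimal WAXp. -/
def AXp {m : ℕ} {D : Fin m → Type*} {T : Type*}
    (π : (∀ i, D i) → T) (v : ∀ i, D i)
    (simD : ∀ i, D i → D i → Prop) (simT : T → T → Prop)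
    (S : Finset (Fin m)) : Prop :=
  WAXp π v simD simT S ∧ ∀ S' ⊂ S, ¬ WAXp π v simD simT S'

/-- The characteristic function `ν_a`: takes value 1 on WAXps and 0 otherwise. -/
noncomputable def nuA {m : ℕ} {D : Fin m → Type*} {T : Type*}
    (π : (∀ i, D i) → T) (v : ∀ i, D i)
    (simD : ∀ i, D i → D i → Prop) (simT : T → T → Prop)
    (S : Finset (Fin m)) : ℝ := by
  classical exact if WAXp π v simD simT S then 1 else 0

/-- Given a permutation `P` of the features (where `P k` is the `k`-th feature in
the permutation ordering), `PrefP P i` is the set of features occurring strictly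
before `i` in `P`. -/
def PrefP {m : ℕ} (P : Equiv.Perm (Fin m)) (i : Fin m) : Finset (Fin m) :=
  Finset.univ.filter (fun j => P.symm j < P.symm i)

theorem WAXp.mono {m : ℕ} {D : Fin m → Type*} {T : Type*}
    {π : (∀ i, D i) → T} {v : ∀ i, D i}
    {simD : ∀ i, D i → D i → Prop} {simT : T → T → Prop}
    {S S' : Finset (Fin m)} (hS : WAXp π v simD simT S) (h : S ⊆ S') :
    WAXp π v simD simT S' :=
  fun x hx => hS x fun i hi => hx i (h hi)

theorem WAXp.exists_subset_AXp {m : ℕ} {D : Fin m → Type*} {T : Type*}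
    {π : (∀ i, D i) → T} {v : ∀ i, D i}
    {simD : ∀ i, D i → D i → Prop} {simT : T → T → Prop}
    {S : Finset (Fin m)} (hS : WAXp π v simD simT S) :
    ∃ A ⊆ S, AXp π v simD simT A := by
  obtain ⟨A, hAS, hA⟩ := exists_minimal_le_of_wellFoundedLT (WAXp π v simD simT) S hS
  exact ⟨A, hAS, hA.prop, fun _ hlt => hA.not_prop_of_lt hlt⟩

theorem WAXp_insert_iff_of_irrelevant {m : ℕ} {D : Fin m → Type*} {T : Type*}
    {π : (∀ i, D i) → T} {v : ∀ i, D i}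
    {simD : ∀ i, D i → D i → Prop} {simT : T → T → Prop} {i : Fin m}
    (hirr : ¬ ∃ A : Finset (Fin m), AXp π v simD simT A ∧ i ∈ A) (S : Finset (Fin m)) :
    WAXp π v simD simT (insert i S) ↔ WAXp π v simD simT S := by
  refine ⟨fun h => ?_, fun h => h.mono (Finset.subset_insert i S)⟩
  obtain ⟨A, hAS, hA⟩ := h.exists_subset_AXp
  have hiA : i ∉ A := fun hi => hirr ⟨A, hA, hi⟩
  exact hA.1.mono ((Finset.subset_insert_iff_of_notMem hiA).1 hAS)

theorem nuA_congr {m : ℕ} {D : Fin m → Type*} {T : Type*}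
    {π : (∀ i, D i) → T} {v : ∀ i, D i}
    {simD : ∀ i, D i → D i → Prop} {simT : T → T → Prop} {S S' : Finset (Fin m)}
    (h : WAXp π v simD simT S ↔ WAXp π v simD simT S') :
    nuA π v simD simT S = nuA π v simD simT S' := by
  classical exact if_congr h rfl rfl

/-- for an irrelevant feature, the permutation-sampling (CGT) estimate
of its Shapley value w.r.t. `ν_a` is exactly zero, for any finite list of
permutations. -/
theorem cgt_estimate_irrelevant_zero {m : ℕ} {D : Fin m → Type*} {T : Type*}
    (π : (∀ i, D i) → T) (v : ∀ i, D i)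
    (simD : ∀ i, D i → D i → Prop) (simT : T → T → Prop)
    {r : ℕ} (hr : 1 ≤ r) (Ps : Fin r → Equiv.Perm (Fin m))
    (i : Fin m)
    (hirr : ¬ ∃ A : Finset (Fin m), AXp π v simD simT A ∧ i ∈ A) :
    (1 / (r : ℝ)) * ∑ j : Fin r,
        (nuA π v simD simT (insert i (PrefP (Ps j) i)) -
          nuA π v simD simT (PrefP (Ps j) i)) = 0 := by
  simp [nuA_congr (WAXp_insert_iff_of_irrelevant hirr _)]
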